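/- (Equation (4.8): anticoercivity of the fibering map) Assume (h1), (h2), (h3) and let f satisfy (f1)–(f4). Let u ∈ X with u⁺ ≠ 0 and u⁻ ≠ 0. Then J(t u⁺ + s u⁻) → −∞ as t² + s² → ∞ with t, s ≥ 0; that is, for every A ∈ ℝ there exists ρ > 0 such that J(t u⁺ + s u⁻) ≤ A whenever t, s ≥ 0 and t² + s² ≥ ρ². -/

import Mathlib

open MeasureTheory Filter

noncomputable section

namespace ZeroMass

/-- The ambient Euclidean space `ℝ^N`. -/
abbrev EN (N : ℕ) := EuclideanSpace ℝ (Fin N)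

/-- The critical fractional Sobolev exponent `2*_α = 2N/(N-2α)`. -/
def critExp (N : ℕ) (α : ℝ) : ℝ := 2 * N / (N - 2 * α)

/-- The square of the Gagliardo seminorm `[u]²`. -/
def gagSq (N : ℕ) (α : ℝ) (u : EN N → ℝ) : ENNReal :=
  ∫⁻ p : EN N × EN N, ENNReal.ofReal ((u p.1 - u p.2) ^ 2 / ‖p.1 - p.2‖ ^ ((N : ℝ) + 2 * α))

/-- The square of the full norm `‖u‖² = [u]² + ∫ V u²`. -/
def normSq {N : ℕ} (α : ℝ) (V : EN N → ℝ) (u : EN N → ℝ) : ENNReal :=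
  gagSq N α u + ∫⁻ x, ENNReal.ofReal (V x * u x ^ 2)

/-- Membership in the space `X`. -/
def memX {N : ℕ} (α : ℝ) (V : EN N → ℝ) (u : EN N → ℝ) : Prop :=
  Measurable u ∧ normSq α V u < ⊤

/-- The norm of `X`, i.e. `‖u‖ = ([u]² + ∫ V u²)^{1/2}`. -/
def Xnorm {N : ℕ} (α : ℝ) (V : EN N → ℝ) (u : EN N → ℝ) : ℝ :=
  ((normSq α V u).toReal) ^ (1 / 2 : ℝ)

/-- The primitive `F(t) = ∫₀ᵗ f(τ) dτ`. -/
def prim (f : ℝ → ℝ) (t : ℝ) : ℝ := ∫ τ in (0 : ℝ)..t, f τ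

/-- The energy functional `J`. -/
def Jfun {N : ℕ} (α : ℝ) (V K : EN N → ℝ) (f : ℝ → ℝ) (u : EN N → ℝ) : ℝ :=
  (1 / 2) * (normSq α V u).toReal - ∫ x, K x * prim f (u x)

/-- The pairing `⟨J'(u), φ⟩`. -/
def Jd {N : ℕ} (α : ℝ) (V K : EN N → ℝ) (f : ℝ → ℝ) (u φ : EN N → ℝ) : ℝ :=
  (∫ p : EN N × EN N, (u p.1 - u p.2) * (φ p.1 - φ p.2) / ‖p.1 - p.2‖ ^ ((N : ℝ) + 2 * α))
    + (∫ x, V x * u x * φ x) - ∫ x, K x * f (u x) * φ x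

/-- Positive part `u⁺ = max(u, 0)`. -/
def uplus {N : ℕ} (u : EN N → ℝ) : EN N → ℝ := fun x => max (u x) 0

/-- Negative part `u⁻ = min(u, 0)`. -/
def uminus {N : ℕ} (u : EN N → ℝ) : EN N → ℝ := fun x => min (u x) 0

/-- `u` is not almost everywhere zero. -/
def NotAEZero {N : ℕ} (u : EN N → ℝ) : Prop :=
  ¬ (u =ᵐ[(volume : Measure (EN N))] (0 : EN N → ℝ))

/-- Hypothesis (h1): `V, K > 0` everywhere and `K` bounded. -/
def H1 {N : ℕ} (V K : EN N → ℝ) : Prop :=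
  (∀ x, 0 < V x) ∧ (∀ x, 0 < K x) ∧ ∃ C : ℝ, ∀ x, K x ≤ C

/-- Hypothesis (h2): uniform vanishing of `∫_{A_n ∩ {|x| ≥ r}} K`. -/
def H2 {N : ℕ} (K : EN N → ℝ) : Prop :=
  ∀ (A : ℕ → Set (EN N)) (R : ℝ), 0 < R → (∀ n, MeasurableSet (A n)) →
    (∀ n, volume (A n) ≤ ENNReal.ofReal R) →
    ∀ ε : ℝ, 0 < ε → ∃ r₀ : ℝ, ∀ r : ℝ, r₀ ≤ r → ∀ n,
      (∫⁻ x in A n ∩ {x : EN N | r ≤ ‖x‖}, ENNReal.ofReal (K x)) ≤ ENNReal.ofReal ε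

/-- Hypothesis (h3): `K/V` is bounded. -/
def H3 {N : ℕ} (V K : EN N → ℝ) : Prop := ∃ C : ℝ, ∀ x, K x / V x ≤ C

/-- Hypothesis (h4) with exponent `m`. -/
def H4 {N : ℕ} (α : ℝ) (V K : EN N → ℝ) (m : ℝ) : Prop :=
  2 < m ∧ m < critExp N α ∧
    Tendsto (fun x : EN N => K x / V x ^ ((critExp N α - m) / (critExp N α - 2)))
      (comap (fun x : EN N => ‖x‖) atTop) (nhds 0)

/-- Hypothesis (f1): `f(t)/|t| → 0` as `t → 0`. -/
def Cf1 (f : ℝ → ℝ) : Prop :=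
  Tendsto (fun t : ℝ => f t / |t|) (nhdsWithin 0 {(0 : ℝ)}ᶜ) (nhds 0)

/-- Hypothesis (f̃1): `limsup_{t→0} f(t)/|t|^{m-1} < ∞`. -/
def Cf1' (f : ℝ → ℝ) (m : ℝ) : Prop :=
  ∃ C : ℝ, ∀ᶠ t in nhdsWithin (0 : ℝ) {(0 : ℝ)}ᶜ, f t / |t| ^ (m - 1) ≤ C

/-- Hypothesis (f2) with exponent `p`: `f(t)/|t|^{p-1} → 0` as `|t| → ∞`. -/
def Cf2 (f : ℝ → ℝ) (p : ℝ) : Prop :=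
  Tendsto (fun t : ℝ => f t / |t| ^ (p - 1)) (comap (fun t : ℝ => |t|) atTop) (nhds 0)

/-- Hypothesis (f3): `F(t)/t² → +∞` as `|t| → ∞`. -/
def Cf3 (f : ℝ → ℝ) : Prop :=
  Tendsto (fun t : ℝ => prim f t / t ^ 2) (comap (fun t : ℝ => |t|) atTop) atTop

/-- Hypothesis (f4): `t ↦ f(t)/|t|` is strictly increasing on `ℝ \ {0}`. -/
def Cf4 (f : ℝ → ℝ) : Prop :=
  ∀ s t : ℝ, s ≠ 0 → t ≠ 0 → s < t → f s / |s| < f t / |t|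

/-- Nehari manifold membership, formulated with the pairing `⟨J'(u), u⟩ = 0`. -/
def memNehari {N : ℕ} (α : ℝ) (V K : EN N → ℝ) (f : ℝ → ℝ) (u : EN N → ℝ) : Prop :=
  memX α V u ∧ NotAEZero u ∧ Jd α V K f u u = 0

/-- Nehari manifold membership, formulated as `‖u‖² = ∫ K f(u) u`. -/
def memNehari2 {N : ℕ} (α : ℝ) (V K : EN N → ℝ) (f : ℝ → ℝ) (u : EN N → ℝ) : Prop :=
  memX α V u ∧ NotAEZero u ∧ (normSq α V u).toReal = ∫ x, K x * f (u x) * u x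

/-- Nodal (sign-changing) Nehari set membership. -/
def memM {N : ℕ} (α : ℝ) (V K : EN N → ℝ) (f : ℝ → ℝ) (u : EN N → ℝ) : Prop :=
  memNehari α V K f u ∧ NotAEZero (uplus u) ∧ NotAEZero (uminus u) ∧
    Jd α V K f u (uplus u) = 0 ∧ Jd α V K f u (uminus u) = 0

/-- Weak convergence in `X` of the sequence `u` to `w`. -/
def weakConv {N : ℕ} (α : ℝ) (V : EN N → ℝ) (u : ℕ → EN N → ℝ) (w : EN N → ℝ) : Prop :=
  ∀ v : EN N → ℝ, memX α V v →
    Tendsto (fun n =>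
      (∫ p : EN N × EN N,
        ((u n p.1 - w p.1) - (u n p.2 - w p.2)) * (v p.1 - v p.2)
          / ‖p.1 - p.2‖ ^ ((N : ℝ) + 2 * α))
      + ∫ x, V x * (u n x - w x) * v x) atTop (nhds 0)

end ZeroMass

open ZeroMass

namespace ZeroMass

section Averages

variable {N : ℕ} {α : ℝ} {V u : EN N → ℝ}

lemma ofReal_sq_integral_le {Ω : Type*} [MeasurableSpace Ω] (μ : Measure Ω)
    [IsProbabilityMeasure μ] {g : Ω → ℝ} (hg : Measurable g) :
    ENNReal.ofReal ((∫ x, g x ∂μ) ^ 2) ≤ ∫⁻ x, ENNReal.ofReal (g x ^ 2) ∂μ := by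
  have e : ∀ a : ℝ, ENNReal.ofReal (a ^ 2) = ‖a‖ₑ ^ (2 : ℝ) := fun a => by
    rw [← sq_abs, ENNReal.ofReal_pow (abs_nonneg a), ← Real.norm_eq_abs, ofReal_norm]
    norm_cast
  simp only [e]
  have h := eLpNorm_le_eLpNorm_of_exponent_le (μ := μ) (p := 1) (q := 2) (by norm_num)
    hg.aestronglyMeasurable
  rw [eLpNorm_one_eq_lintegral_enorm,
    eLpNorm_eq_lintegral_rpow_enorm_toReal (by norm_num) (by norm_num)] at h
  calc ‖∫ x, g x ∂μ‖ₑ ^ (2 : ℝ)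
      ≤ ((∫⁻ x, ‖g x‖ₑ ^ (2 : ℝ) ∂μ) ^ (1 / (2 : ℝ))) ^ (2 : ℝ) := by
        gcongr
        exact (enorm_integral_le_lintegral_enorm g).trans (by simpa using h)
    _ = _ := by rw [← ENNReal.rpow_mul]; norm_num

lemma ofReal_sq_integral_sub_integral_le {Ω : Type*} [MeasurableSpace Ω] (P Q : Measure Ω)
    [IsProbabilityMeasure P] [IsProbabilityMeasure Q] {g : Ω → ℝ} (hg : Measurable g)
    (hP : Integrable g P) (hQ : Integrable g Q) :
    ENNReal.ofReal ((∫ x, g x ∂P - ∫ x, g x ∂Q) ^ 2)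
      ≤ ∫⁻ y, ∫⁻ z, ENNReal.ofReal ((g y - g z) ^ 2) ∂Q ∂P := by
  have e : ∫ x, g x ∂P - ∫ x, g x ∂Q = ∫ y, (g y - ∫ z, g z ∂Q) ∂P := by
    rw [integral_sub hP (integrable_const _)]; simp
  rw [e]
  refine (ofReal_sq_integral_le P (hg.sub_const _)).trans (lintegral_mono fun y => ?_)
  have e' : g y - ∫ z, g z ∂Q = ∫ z, (g y - g z) ∂Q := by
    rw [integral_sub (integrable_const _) hQ]; simp
  rw [e']
  exact ofReal_sq_integral_le Q (measurable_const.sub hg)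

/-- The inner integral in the Gagliardo seminorm. -/
def gagDensity (α : ℝ) (u : EN N → ℝ) (x : EN N) : ENNReal :=
  ∫⁻ y, ENNReal.ofReal ((u x - u y) ^ 2 / ‖x - y‖ ^ ((N : ℝ) + 2 * α))

lemma measurable_gagKernel (hu : Measurable u) :
    Measurable fun p : EN N × EN N =>
      ENNReal.ofReal ((u p.1 - u p.2) ^ 2 / ‖p.1 - p.2‖ ^ ((N : ℝ) + 2 * α)) := by
  fun_prop

lemma measurable_gagDensity (hu : Measurable u) : Measurable (gagDensity α u) :=
  (measurable_gagKernel hu).lintegral_prod_right'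

lemma lintegral_gagDensity (hu : Measurable u) : ∫⁻ x, gagDensity α u x = gagSq N α u :=
  (lintegral_prod _ (measurable_gagKernel hu).aemeasurable).symm

/-- The uniform probability measure on a ball. -/
def ballUnif (x : EN N) (r : ℝ) : Measure (EN N) :=
  ProbabilityTheory.cond volume (Metric.ball x r)

/-- The volume of the unit ball. -/
def unitVol (N : ℕ) : ℝ := (volume (Metric.ball (0 : EN N) 1)).toReal

lemma unitVol_pos : 0 < unitVol N :=
  ENNReal.toReal_pos (Metric.measure_ball_pos _ _ one_pos).ne' measure_ball_lt_top.ne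

lemma isProbabilityMeasure_ballUnif (x : EN N) {r : ℝ} (hr : 0 < r) :
    IsProbabilityMeasure (ballUnif x r) :=
  ProbabilityTheory.cond_isProbabilityMeasure_of_finite
    (Metric.measure_ball_pos _ _ hr).ne' measure_ball_lt_top.ne

lemma lintegral_ballUnif_le (hN : 0 < N) (x : EN N) {r : ℝ} (hr : 0 < r) {g h : EN N → ENNReal}
    (hgh : ∀ y ∈ Metric.ball x r, g y ≤ h y) :
    ∫⁻ y, g y ∂ballUnif x r ≤ ENNReal.ofReal (unitVol N * r ^ N)⁻¹ * ∫⁻ y, h y := by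
  have : Nonempty (Fin N) := ⟨⟨0, hN⟩⟩
  have hv : volume (Metric.ball x r) = ENNReal.ofReal (unitVol N * r ^ N) := by
    rw [Measure.addHaar_ball volume x hr.le, finrank_euclideanSpace_fin, mul_comm,
      ENNReal.ofReal_mul unitVol_pos.le, unitVol, ENNReal.ofReal_toReal measure_ball_lt_top.ne]
  rw [ballUnif, ProbabilityTheory.cond, lintegral_smul_measure, hv,
    ENNReal.ofReal_inv_of_pos (mul_pos unitVol_pos (pow_pos hr N)), smul_eq_mul]
  exact mul_le_mul' le_rfl
    ((setLIntegral_mono' measurableSet_ball hgh).trans (setLIntegral_le_lintegral _ _))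

lemma ofReal_sq_sub_le (hα : 0 < α) {L : ℝ} {x y : EN N} (h : ‖x - y‖ ≤ L) :
    ENNReal.ofReal ((u x - u y) ^ 2) ≤ ENNReal.ofReal (L ^ ((N : ℝ) + 2 * α)) *
      ENNReal.ofReal ((u x - u y) ^ 2 / ‖x - y‖ ^ ((N : ℝ) + 2 * α)) := by
  have hL : 0 ≤ L := (norm_nonneg _).trans h
  rw [← ENNReal.ofReal_mul (Real.rpow_nonneg hL _)]
  apply ENNReal.ofReal_le_ofReal
  rcases eq_or_ne x y with rfl | hxy
  · simp
  have hp : 0 < ‖x - y‖ ^ ((N : ℝ) + 2 * α) :=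
    Real.rpow_pos_of_pos (norm_pos_iff.2 (sub_ne_zero.2 hxy)) _
  rw [mul_div_assoc', le_div_iff₀ hp, mul_comm]
  gcongr

lemma integrable_ballUnif (hV : Continuous V) (hVpos : ∀ x, 0 < V x) (hu : Measurable u)
    (hVu : Integrable fun x => V x * u x ^ 2) (x : EN N) {r : ℝ} (hr : 0 < r) :
    Integrable u (ballUnif x r) := by
  obtain ⟨z, -, hz⟩ := (isCompact_closedBall x r).exists_isMinOn
    ⟨x, Metric.mem_closedBall_self hr.le⟩ hV.continuousOn
  have key : IntegrableOn u (Metric.ball x r) := by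
    refine Integrable.mono' (g := fun y => 1 + (V z)⁻¹ * (V y * u y ^ 2))
      (Integrable.add (integrable_const_iff.2 (.inr ⟨by simp [measure_ball_lt_top]⟩))
        (hVu.const_mul _).integrableOn)
      hu.aestronglyMeasurable ?_
    refine (ae_restrict_iff' measurableSet_ball).2 (.of_forall fun y hy => ?_)
    have hzy : V z ≤ V y := hz (Metric.ball_subset_closedBall hy)
    have h1 : u y ^ 2 ≤ (V z)⁻¹ * (V y * u y ^ 2) := by
      rw [inv_mul_eq_div, le_div_iff₀ (hVpos z), mul_comm]
      gcongr
    have := abs_nonneg (u y)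
    rw [Real.norm_eq_abs]
    nlinarith [sq_abs (u y), sq_nonneg (|u y| - 1)]
  exact key.smul_measure (ENNReal.inv_ne_top.2 (Metric.measure_ball_pos _ _ hr).ne')

/-- The average over a ball centred at `x` is close to the value at `x`. -/
lemma ofReal_sq_sub_average_le (hN : 0 < N) (hα : 0 < α) (hu : Measurable u) (x : EN N) {r : ℝ}
    (hr : 0 < r) (hi : Integrable u (ballUnif x r)) :
    ENNReal.ofReal ((u x - ∫ y, u y ∂ballUnif x r) ^ 2) ≤
      ENNReal.ofReal ((unitVol N)⁻¹ * r ^ (2 * α)) * gagDensity α u x := by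
  have := isProbabilityMeasure_ballUnif x hr
  have e : u x - ∫ y, u y ∂ballUnif x r = ∫ y, (u x - u y) ∂ballUnif x r := by
    rw [integral_sub (integrable_const _) hi]; simp
  rw [e]
  refine (ofReal_sq_integral_le _ (measurable_const.sub hu)).trans ?_
  refine (lintegral_ballUnif_le hN x hr fun y hy => ofReal_sq_sub_le (L := r) hα ?_).trans ?_
  · rw [← dist_eq_norm, dist_comm]; exact (Metric.mem_ball.1 hy).le
  · rw [lintegral_const_mul' _ _ ENNReal.ofReal_ne_top, ← mul_assoc,
      ← ENNReal.ofReal_mul (by have := @unitVol_pos N; positivity), gagDensity]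
    apply le_of_eq
    congr 2
    rw [Real.rpow_add hr, Real.rpow_natCast]
    field_simp

/-- Averages over nearby balls of comparable radii are close to each other. -/
lemma ofReal_sq_average_sub_average_le (hN : 0 < N) (hα : 0 < α) (hu : Measurable u)
    (x y : EN N) {r s L : ℝ} (hr : 0 < r) (hs : r ≤ s) (hL : r + s + dist x y ≤ L)
    (hi : Integrable u (ballUnif x r)) (hi' : Integrable u (ballUnif y s)) :
    ENNReal.ofReal ((∫ z, u z ∂ballUnif x r - ∫ z, u z ∂ballUnif y s) ^ 2) ≤
      ENNReal.ofReal ((unitVol N * r ^ N)⁻¹ ^ 2 * L ^ ((N : ℝ) + 2 * α)) * gagSq N α u := by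
  have := isProbabilityMeasure_ballUnif x hr
  have := isProbabilityMeasure_ballUnif y (hr.trans_le hs)
  have hω := @unitVol_pos N
  have hs0 := hr.trans_le hs
  have hL0 : 0 < L := by have := @dist_nonneg _ _ x y; linarith
  refine (ofReal_sq_integral_sub_integral_le _ _ hu hi hi').trans ?_
  have hin : ∀ z ∈ Metric.ball x r, ∫⁻ w, ENNReal.ofReal ((u z - u w) ^ 2) ∂ballUnif y s ≤
      ENNReal.ofReal ((unitVol N * r ^ N)⁻¹ * L ^ ((N : ℝ) + 2 * α)) * gagDensity α u z := by
    intro z hz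
    refine (lintegral_ballUnif_le hN y hs0 fun w hw => ofReal_sq_sub_le (L := L) hα ?_).trans ?_
    · rw [← dist_eq_norm]
      have h1 := Metric.mem_ball.1 hz
      have h2 := Metric.mem_ball'.1 hw
      linarith [dist_triangle4 z x y w]
    · rw [lintegral_const_mul' _ _ ENNReal.ofReal_ne_top, ← mul_assoc,
        ← ENNReal.ofReal_mul (by positivity), gagDensity]
      gcongr
  refine (lintegral_ballUnif_le hN x hr hin).trans ?_
  rw [lintegral_const_mul' _ _ ENNReal.ofReal_ne_top, ← mul_assoc,
    ← ENNReal.ofReal_mul (by positivity), lintegral_gagDensity hu, ← mul_assoc, ← sq]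

lemma abs_le_mul_sqrt_of_ofReal_sq_le {a c : ℝ} {d : ENNReal} (hc : 0 ≤ c) (hd : d ≠ ⊤)
    (h : ENNReal.ofReal (a ^ 2) ≤ ENNReal.ofReal c * d) : |a| ≤ √c * √d.toReal := by
  rw [← ENNReal.ofReal_toReal hd, ← ENNReal.ofReal_mul hc,
    ENNReal.ofReal_le_ofReal_iff (mul_nonneg hc ENNReal.toReal_nonneg)] at h
  rw [← Real.sqrt_mul hc]
  exact Real.abs_le_sqrt h

lemma exists_abs_average_sub_average_le (hN : 0 < N) (hα : 0 < α) (hu : Measurable u)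
    (hD : gagSq N α u ≠ ⊤) (hi : ∀ x r, 0 < r → Integrable u (ballUnif x r)) :
    ∃ C : ℝ, 0 ≤ C ∧ ∀ (x y : EN N) (r s : ℝ), 0 < r → r ≤ s → s + dist x y ≤ 3 * r →
      |∫ z, u z ∂ballUnif x r - ∫ z, u z ∂ballUnif y s| ≤ C * r ^ (-((N : ℝ) / 2 - α)) := by
  have hω := @unitVol_pos N
  refine ⟨√((unitVol N)⁻¹ ^ 2 * 4 ^ ((N : ℝ) + 2 * α)) * √(gagSq N α u).toReal, by positivity,
    fun x y r s hr hs hL => ?_⟩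
  refine (abs_le_mul_sqrt_of_ofReal_sq_le (by positivity) hD
    (ofReal_sq_average_sub_average_le (L := 4 * r) hN hα hu x y hr hs (by linarith)
      (hi _ _ hr) (hi _ _ (hr.trans_le hs)))).trans_eq ?_
  have e : (unitVol N * r ^ N)⁻¹ ^ 2 * (4 * r) ^ ((N : ℝ) + 2 * α) =
      ((unitVol N)⁻¹ ^ 2 * 4 ^ ((N : ℝ) + 2 * α)) * (r ^ (-((N : ℝ) / 2 - α))) ^ 2 := by
    have h1 : (r ^ (-((N : ℝ) / 2 - α))) ^ 2 = (r ^ N)⁻¹ ^ 2 * r ^ ((N : ℝ) + 2 * α) := by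
      rw [← Real.rpow_natCast r N, ← Real.rpow_neg hr.le, ← Real.rpow_natCast,
        ← Real.rpow_natCast, ← Real.rpow_mul hr.le, ← Real.rpow_mul hr.le, ← Real.rpow_add hr]
      congr 1
      push_cast
      ring
    rw [h1, Real.mul_rpow (by norm_num) hr.le, mul_inv]
    ring
  rw [e, Real.sqrt_mul (by positivity), Real.sqrt_sq (by positivity)]
  ring

/-- Averages over balls of the same radius but arbitrary centres stay within a multiple of
`r ^ (α - N / 2)`. -/
lemma exists_abs_average_sub_average_same_radius_le (hN : 2 * α < N) (hα : 0 < α)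
    (hu : Measurable u) (hD : gagSq N α u ≠ ⊤)
    (hi : ∀ x r, 0 < r → Integrable u (ballUnif x r)) :
    ∃ C : ℝ, 0 ≤ C ∧ ∀ (x y : EN N) (r : ℝ), 0 < r →
      |∫ z, u z ∂ballUnif x r - ∫ z, u z ∂ballUnif y r| ≤ C * r ^ (-((N : ℝ) / 2 - α)) := by
  have hN0 : 0 < N := by
    have : (0 : ℝ) < N := by linarith
    exact_mod_cast this
  obtain ⟨C, hC, h⟩ := exists_abs_average_sub_average_le hN0 hα hu hD hi
  set β : ℝ := (N : ℝ) / 2 - α with hβ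
  have hβ0 : 0 < β := by rw [hβ]; linarith
  set q : ℝ := 2 ^ (-β) with hq
  have hq0 : 0 < q := by positivity
  have hq1 : q < 1 := Real.rpow_lt_one_of_one_lt_of_neg (by norm_num) (by linarith)
  have scale : ∀ (r : ℝ) (k : ℕ), 0 < r → (2 ^ k * r) ^ (-β) = q ^ k * r ^ (-β) := by
    intro r k hr
    rw [Real.mul_rpow (by positivity) hr.le, hq, ← Real.rpow_natCast, ← Real.rpow_natCast,
      ← Real.rpow_mul (by norm_num), ← Real.rpow_mul (by norm_num), mul_comm (k : ℝ)]
  have chain : ∀ (x : EN N) (r : ℝ) (k : ℕ), 0 < r →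
      |∫ z, u z ∂ballUnif x r - ∫ z, u z ∂ballUnif x (2 ^ k * r)| ≤
        C * (1 - q)⁻¹ * r ^ (-β) := by
    intro x r k hr
    have h' := dist_le_range_sum_of_dist_le (f := fun k : ℕ => ∫ z, u z ∂ballUnif x (2 ^ k * r)) k
      (d := fun k => C * (q ^ k * r ^ (-β))) (fun {j} _ => by
        rw [Real.dist_eq, ← scale r j hr]
        refine h x x _ _ (by positivity) ?_ ?_
        · rw [pow_succ]
          have : 0 < 2 ^ j * r := by positivity
          linarith
        · rw [pow_succ, dist_self]
          have : 0 < 2 ^ j * r := by positivity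
          linarith)
    simp only [Real.dist_eq, pow_zero, one_mul] at h'
    refine h'.trans ?_
    rw [← Finset.mul_sum, ← Finset.sum_mul, mul_assoc]
    gcongr
    rw [← tsum_geometric_of_lt_one hq0.le hq1]
    exact (summable_geometric_of_lt_one hq0.le hq1).sum_le_tsum _ fun _ _ => by positivity
  refine ⟨2 * (C * (1 - q)⁻¹) + C, ?_, fun x y r hr => ?_⟩
  · have := inv_nonneg.2 (sub_nonneg.2 hq1.le)
    positivity
  obtain ⟨k, hk⟩ := pow_unbounded_of_one_lt (dist x y / r) (one_lt_two (α := ℝ))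
  rw [div_lt_iff₀ hr] at hk
  have hk0 : 0 < 2 ^ k * r := by positivity
  have h1 := abs_le.1 (chain x r k hr)
  have h2 := abs_le.1 (chain y r k hr)
  have h3 := h x y (2 ^ k * r) (2 ^ k * r) hk0 le_rfl (by linarith)
  have h4 : C * (2 ^ k * r) ^ (-β) ≤ C * r ^ (-β) := by
    rw [scale r k hr]
    gcongr
    exact mul_le_of_le_one_left (by positivity) (pow_le_one₀ hq0.le hq1.le)
  have h5 := abs_le.1 (h3.trans h4)
  rw [abs_le]
  constructor <;> linarith [h1.1, h1.2, h2.1, h2.2, h5.1, h5.2]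

/-- Pointwise form of the fractional Sobolev inequality. -/
lemma exists_abs_le_add_mul_gagDensity_rpow (hN : 2 * α < N) (hα : 0 < α)
    (hu : Measurable u) (hD : gagSq N α u ≠ ⊤)
    (hi : ∀ x r, 0 < r → Integrable u (ballUnif x r)) :
    ∃ l C : ℝ, 0 ≤ l ∧ 0 ≤ C ∧ ∀ x, gagDensity α u x ≠ ⊤ →
      |u x| ≤ l + C * (gagDensity α u x).toReal ^ (1 / 2 - α / N) := by
  have hN0' : (0 : ℝ) < N := by linarith
  have hN0 : 0 < N := by exact_mod_cast hN0'
  by_cases hex : ∃ x₀, gagDensity α u x₀ ≠ ⊤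
  swap
  · exact ⟨0, 0, le_rfl, le_rfl, fun x hx => (hex ⟨x, hx⟩).elim⟩
  obtain ⟨x₀, hx₀⟩ := hex
  have hω := @unitVol_pos N
  obtain ⟨C, hC, h⟩ := exists_abs_average_sub_average_same_radius_le hN hα hu hD hi
  set A : ℝ := √(unitVol N)⁻¹ with hA
  have hA0 : 0 ≤ A := Real.sqrt_nonneg _
  have hpt : ∀ x r, 0 < r → gagDensity α u x ≠ ⊤ →
      |u x - ∫ y, u y ∂ballUnif x r| ≤ A * r ^ α * √(gagDensity α u x).toReal := by
    intro x r hr hx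
    refine (abs_le_mul_sqrt_of_ofReal_sq_le (by positivity) hx
      (ofReal_sq_sub_average_le hN0 hα hu x hr (hi x r hr))).trans_eq ?_
    rw [Real.sqrt_mul (by positivity), mul_comm 2 α, Real.rpow_mul hr.le, Real.rpow_two,
      Real.sqrt_sq (by positivity)]
  set g₀ := √(gagDensity α u x₀).toReal with hg₀
  have hg₀0 : 0 ≤ g₀ := Real.sqrt_nonneg _
  have main : ∀ x r, 0 < r → r ≤ 1 → gagDensity α u x ≠ ⊤ → |u x| ≤ A * g₀ + |u x₀| +
      (A * (r ^ α * √(gagDensity α u x).toReal) + C * r ^ (-((N : ℝ) / 2 - α))) := by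
    intro x r hr hr1 hx
    have h1 := abs_le.1 (hpt x r hr hx)
    have h2 := abs_le.1 (hpt x₀ r hr hx₀)
    have h3 := abs_le.1 (h x x₀ r hr)
    have h4 : A * r ^ α * g₀ ≤ A * g₀ := by
      gcongr
      exact mul_le_of_le_one_right hA0 (Real.rpow_le_one hr.le hr1 hα.le)
    rw [← hg₀] at h2
    have h5 := abs_le.1 (le_refl |u x₀|)
    rw [abs_le]
    constructor <;> linarith [h1.1, h1.2, h2.1, h2.2, h3.1, h3.2, h5.1, h5.2]
  refine ⟨A * g₀ + |u x₀| + (A + C), A + C, by positivity, by positivity, fun x hx => ?_⟩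
  have hg0 : 0 ≤ (gagDensity α u x).toReal := ENNReal.toReal_nonneg
  set g := (gagDensity α u x).toReal with hg
  rcases le_total g 1 with hg1 | hg1
  · have h1 := main x 1 one_pos le_rfl hx
    rw [Real.one_rpow, Real.one_rpow, one_mul, mul_one] at h1
    have h2 : A * √g ≤ A := mul_le_of_le_one_right hA0 (Real.sqrt_le_one.2 hg1)
    have : 0 ≤ (A + C) * g ^ (1 / 2 - α / N) := by positivity
    linarith
  · have hgp : 0 < g := by linarith
    have hr : 0 < g ^ (-(1 / N : ℝ)) := Real.rpow_pos_of_pos hgp _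
    have h1 := main x (g ^ (-(1 / N : ℝ))) hr
      (Real.rpow_le_one_of_one_le_of_nonpos hg1 (by simp)) hx
    rw [← hg, Real.sqrt_eq_rpow, ← Real.rpow_mul hg0, ← Real.rpow_mul hg0,
      ← Real.rpow_add hgp] at h1
    have e1 : -(1 / N : ℝ) * α + 1 / 2 = 1 / 2 - α / N := by ring
    have e2 : -(1 / N : ℝ) * -((N : ℝ) / 2 - α) = 1 / 2 - α / N := by field_simp
    rw [e1, e2] at h1
    linarith

end Averages

section Integrability

variable {N : ℕ} {α : ℝ} {V K u : EN N → ℝ} {f : ℝ → ℝ}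

lemma critExp_mul (hN : 2 * α < N) (hα : 0 < α) : (1 / 2 - α / N) * critExp N α = 1 := by
  have h1 : (0 : ℝ) < N := by linarith
  have h2 : (N : ℝ) - 2 * α ≠ 0 := by linarith
  rw [critExp]
  field_simp

lemma two_le_critExp (hN : 2 * α < N) (hα : 0 < α) : 2 ≤ critExp N α := by
  rw [critExp, le_div_iff₀ (by linarith)]
  linarith

lemma integrable_mul_sq (hV : Continuous V) (hu : memX α V u) (hVpos : ∀ x, 0 < V x) :
    Integrable fun x => V x * u x ^ 2 := by
  refine ⟨(hV.measurable.mul (hu.1.pow_const 2)).aestronglyMeasurable, ?_⟩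
  rw [hasFiniteIntegral_iff_ofReal (.of_forall fun x => mul_nonneg (hVpos x).le (sq_nonneg _))]
  exact lt_of_le_of_lt le_add_self hu.2

lemma integrable_weight_mul_sq (hK : Continuous K) (hu : Measurable u)
    (h1 : H1 V K) (h3 : H3 V K) (hVu : Integrable fun x => V x * u x ^ 2) :
    Integrable fun x => K x * u x ^ 2 := by
  obtain ⟨C, hC⟩ := h3
  refine (hVu.const_mul C).mono' (hK.measurable.mul (hu.pow_const 2)).aestronglyMeasurable
    (.of_forall fun x => ?_)
  rw [Real.norm_of_nonneg (mul_nonneg (h1.2.1 x).le (sq_nonneg _)), ← mul_assoc]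
  gcongr
  exact (div_le_iff₀ (h1.1 x)).1 (hC x)

lemma integrable_weight_mul_rpow (hα : 0 < α) (hN : 2 * α < N) (hV : Continuous V)
    (hK : Continuous K) (h1 : H1 V K) (h3 : H3 V K) (hu : memX α V u) :
    Integrable fun x => K x * |u x| ^ critExp N α := by
  obtain ⟨hum, hfin⟩ := hu
  have hVu := integrable_mul_sq hV ⟨hum, hfin⟩ h1.1
  have hKu := integrable_weight_mul_sq hK hum h1 h3 hVu
  have hN0 : 0 < N := by
    have : (0 : ℝ) < N := by linarith
    exact_mod_cast this
  have hD : gagSq N α u ≠ ⊤ := (lt_of_le_of_lt le_self_add hfin).ne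
  have hp2 := two_le_critExp hN hα
  have hpc := critExp_mul hN hα
  set p := critExp N α
  obtain ⟨l, C, hl, hC, hb⟩ := exists_abs_le_add_mul_gagDensity_rpow hN hα hum hD
    fun x r hr => integrable_ballUnif hV h1.1 hum hVu x hr
  obtain ⟨k, hk⟩ := h1.2.2
  have hGm := measurable_gagDensity (α := α) hum
  have hG : ∫⁻ x, gagDensity α u x ≠ ⊤ := by rwa [lintegral_gagDensity hum]
  have hGi : Integrable fun x => (gagDensity α u x).toReal :=
    integrable_toReal_of_lintegral_ne_top hGm.aemeasurable hG
  refine ((hKu.const_mul ((2 * l) ^ (p - 2))).add (hGi.const_mul (k * (2 * C) ^ p))).mono'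
    (hK.measurable.mul (hum.abs.pow_const p)).aestronglyMeasurable ?_
  filter_upwards [ae_lt_top hGm hG] with x hx
  have hKx := h1.2.1 x
  have hk0 : 0 < k := hKx.trans_le (hk x)
  have hg0 : 0 ≤ (gagDensity α u x).toReal := ENNReal.toReal_nonneg
  rw [Real.norm_of_nonneg (by positivity), Pi.add_apply]
  rcases le_total |u x| (2 * l) with h | h
  · have e : |u x| ^ p ≤ (2 * l) ^ (p - 2) * u x ^ 2 := by
      rcases (abs_nonneg (u x)).eq_or_lt with h0 | h0
      · rw [← h0, Real.zero_rpow (by linarith)]; positivity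
      · rw [← sq_abs, ← Real.rpow_two, ← sub_add_cancel p 2, Real.rpow_add h0,
          sub_add_cancel]
        gcongr
    have : K x * |u x| ^ p ≤ (2 * l) ^ (p - 2) * (K x * u x ^ 2) := by
      calc _ ≤ K x * ((2 * l) ^ (p - 2) * u x ^ 2) := by gcongr
        _ = _ := by ring
    have : 0 ≤ k * (2 * C) ^ p * (gagDensity α u x).toReal := by positivity
    linarith
  · have h2 : |u x| ≤ 2 * C * (gagDensity α u x).toReal ^ (1 / 2 - α / N) := by
      have := hb x hx.ne
      linarith
    have h3 : |u x| ^ p ≤ (2 * C) ^ p * (gagDensity α u x).toReal := by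
      calc |u x| ^ p ≤ (2 * C * (gagDensity α u x).toReal ^ (1 / 2 - α / N)) ^ p := by gcongr
        _ = _ := by
          rw [Real.mul_rpow (by positivity) (by positivity), ← Real.rpow_mul hg0, hpc,
            Real.rpow_one]
    have : K x * |u x| ^ p ≤ k * ((2 * C) ^ p * (gagDensity α u x).toReal) := by
      gcongr
      exact hk x
    have : 0 ≤ (2 * l) ^ (p - 2) * (K x * u x ^ 2) := by positivity
    linarith

lemma exists_abs_le_of_growth {p : ℝ} (hf : Continuous f) (hf1 : Cf1 f) (hf2 : Cf2 f p) :
    ∃ C : ℝ, 0 ≤ C ∧ ∀ t, |f t| ≤ C * (|t| + |t| ^ (p - 1)) := by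
  have hsmall := Metric.tendsto_nhdsWithin_nhds.1 hf1 1 one_pos
  obtain ⟨δ, hδ, hs⟩ := hsmall
  have hs' : ∀ t, t ≠ 0 → |t| < δ → |f t| ≤ |t| := by
    intro t ht htδ
    have := hs (x := t) ht (by simpa using htδ)
    rw [dist_zero_right, Real.norm_eq_abs, abs_div, abs_abs, div_lt_one (abs_pos.2 ht)] at this
    exact this.le
  have hf0 : f 0 = 0 := by
    have h1 : Tendsto f (nhdsWithin 0 {(0 : ℝ)}ᶜ) (nhds (f 0)) := hf.continuousAt.continuousWithinAt
    have h2 : Tendsto (fun t : ℝ => |t|) (nhdsWithin 0 {(0 : ℝ)}ᶜ) (nhds 0) := by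
      have : Continuous fun t : ℝ => |t| := continuous_abs
      simpa using (this.tendsto 0).mono_left nhdsWithin_le_nhds
    have h3 := hf1.mul h2
    rw [zero_mul] at h3
    refine tendsto_nhds_unique h1 (h3.congr' ?_)
    filter_upwards [self_mem_nhdsWithin] with t ht
    exact div_mul_cancel₀ _ (abs_pos.2 ht).ne'
  have hlarge : ∀ᶠ t in comap (fun t : ℝ => |t|) atTop, |f t / |t| ^ (p - 1)| < 1 := by
    have := hf2.abs.eventually (gt_mem_nhds (by simp : |(0 : ℝ)| < 1))
    exact this
  obtain ⟨T, hT⟩ := eventually_atTop.1 (eventually_comap.1 hlarge)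
  obtain ⟨M, hM⟩ := (isCompact_Icc (a := -T) (b := T)).exists_bound_of_continuousOn
    hf.continuousOn
  refine ⟨1 + |M| / δ, by positivity, fun t => ?_⟩
  rcases eq_or_ne t 0 with rfl | ht
  · rw [hf0, abs_zero]; positivity
  have ht0 := abs_pos.2 ht
  have hp0 : 0 < |t| ^ (p - 1) := Real.rpow_pos_of_pos ht0 _
  have hc : 0 ≤ |M| / δ := by positivity
  rcases lt_or_ge |t| δ with h | h
  · nlinarith [hs' t ht h]
  rcases le_total T |t| with h' | h'
  · have := hT _ h' t rfl
    rw [abs_div, abs_of_pos hp0, div_lt_one hp0] at this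
    nlinarith
  · have h2 : |f t| ≤ |M| := (hM t (abs_le.1 h')).trans (le_abs_self M)
    have h3 : |M| ≤ |M| / δ * |t| := by
      rw [div_mul_eq_mul_div, le_div_iff₀ hδ]
      gcongr
    nlinarith

lemma exists_abs_prim_le {p : ℝ} (hp : 2 ≤ p) (hf : Continuous f) (hf1 : Cf1 f) (hf2 : Cf2 f p) :
    ∃ C : ℝ, 0 ≤ C ∧ ∀ t, |prim f t| ≤ C * (t ^ 2 + |t| ^ p) := by
  obtain ⟨C, hC, h⟩ := exists_abs_le_of_growth hf hf1 hf2
  refine ⟨C, hC, fun t => ?_⟩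
  have := intervalIntegral.norm_integral_le_of_norm_le_const (a := 0) (b := t) (f := f)
    (C := C * (|t| + |t| ^ (p - 1))) fun τ hτ => by
      have hτt : |τ| ≤ |t| := by
        have := Set.abs_sub_left_of_mem_uIcc (Set.uIoc_subset_uIcc hτ)
        simpa using this
      refine (h τ).trans ?_
      gcongr
      linarith
  rw [sub_zero, Real.norm_eq_abs] at this
  refine this.trans_eq ?_
  have e : |t| ^ (p - 1) * |t| = |t| ^ p := by
    rcases (abs_nonneg t).eq_or_lt with h0 | h0
    · rw [← h0, mul_zero, Real.zero_rpow (by linarith)]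
    · rw [← Real.rpow_add_one h0.ne', sub_add_cancel]
  rw [← e, ← sq_abs t]
  ring

lemma continuous_prim (hf : Continuous f) : Continuous (prim f) :=
  intervalIntegral.continuous_primitive (fun a b => hf.intervalIntegrable a b) 0

lemma integrable_weight_mul_prim (hα : 0 < α) (hN : 2 * α < N) (hV : Continuous V)
    (hK : Continuous K) (hf : Continuous f) (h1 : H1 V K) (h3 : H3 V K) (hf1 : Cf1 f)
    (hf2 : Cf2 f (critExp N α)) (hu : memX α V u) {w : EN N → ℝ} (hw : Measurable w) {M : ℝ}
    (hwu : ∀ x, |w x| ≤ M * |u x|) : Integrable fun x => K x * prim f (w x) := by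
  have hp2 := two_le_critExp hN hα
  obtain ⟨C, hC, h⟩ := exists_abs_prim_le hp2 hf hf1 hf2
  have i1 := integrable_weight_mul_sq hK hu.1 h1 h3 (integrable_mul_sq hV hu h1.1)
  have i2 := integrable_weight_mul_rpow hα hN hV hK h1 h3 hu
  refine ((i1.const_mul (C * M ^ 2)).add (i2.const_mul (C * |M| ^ critExp N α))).mono'
    (hK.measurable.mul ((continuous_prim hf).measurable.comp hw)).aestronglyMeasurable
    (.of_forall fun x => ?_)
  have hKx := h1.2.1 x
  have hwx : |w x| ≤ |M| * |u x| := (hwu x).trans (by gcongr; exact le_abs_self M)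
  rw [norm_mul, Real.norm_of_nonneg hKx.le, Real.norm_eq_abs, Pi.add_apply]
  calc K x * |prim f (w x)| ≤ K x * (C * (w x ^ 2 + |w x| ^ critExp N α)) := by
        gcongr; exact h _
    _ ≤ K x * (C * ((|M| * |u x|) ^ 2 + (|M| * |u x|) ^ critExp N α)) := by
        rw [← sq_abs (w x)]
        gcongr
    _ = _ := by
        rw [Real.mul_rpow (abs_nonneg _) (abs_nonneg _), mul_pow, sq_abs, sq_abs]
        ring

end Integrability

section Fibering

variable {N : ℕ} {α : ℝ} {V K u : EN N → ℝ} {f : ℝ → ℝ}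

lemma nonneg_and_nonpos_of_Cf4 (hf1 : Cf1 f) (hf4 : Cf4 f) :
    (∀ t, 0 < t → 0 ≤ f t) ∧ ∀ t, t < 0 → f t ≤ 0 := by
  constructor
  · intro t ht
    have h1 : Tendsto (fun t : ℝ => f t / |t|) (nhdsWithin 0 (Set.Ioi 0)) (nhds 0) :=
      hf1.mono_left (nhdsWithin_mono _ fun x (hx : 0 < x) => hx.ne')
    have h2 : 0 ≤ f t / |t| := by
      refine le_of_tendsto h1 ?_
      filter_upwards [Ioo_mem_nhdsGT ht] with s hs
      exact (hf4 s t hs.1.ne' ht.ne' hs.2).le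
    rwa [le_div_iff₀ (abs_pos.2 ht.ne'), zero_mul] at h2
  · intro t ht
    have h1 : Tendsto (fun t : ℝ => f t / |t|) (nhdsWithin 0 (Set.Iio 0)) (nhds 0) :=
      hf1.mono_left (nhdsWithin_mono _ fun x (hx : x < 0) => hx.ne)
    have h2 : f t / |t| ≤ 0 := by
      refine ge_of_tendsto h1 ?_
      filter_upwards [Ioo_mem_nhdsLT ht] with s hs
      exact (hf4 t s ht.ne hs.2.ne hs.1).le
    rwa [div_le_iff₀ (abs_pos.2 ht.ne), zero_mul] at h2

lemma prim_nonneg (hf : Continuous f) (hf1 : Cf1 f) (hf4 : Cf4 f) (t : ℝ) : 0 ≤ prim f t := by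
  obtain ⟨hpos, hneg⟩ := nonneg_and_nonpos_of_Cf4 hf1 hf4
  have cl : ∀ s, (0 ≤ s → 0 ≤ f s) ∧ (s ≤ 0 → f s ≤ 0) := by
    have h0 : 0 ≤ f 0 := by
      have : Tendsto f (nhdsWithin 0 (Set.Ioi 0)) (nhds (f 0)) :=
        hf.continuousAt.continuousWithinAt
      refine ge_of_tendsto this ?_
      filter_upwards [self_mem_nhdsWithin] with s hs using hpos s hs
    have h0' : f 0 ≤ 0 := by
      have : Tendsto f (nhdsWithin 0 (Set.Iio 0)) (nhds (f 0)) :=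
        hf.continuousAt.continuousWithinAt
      refine le_of_tendsto this ?_
      filter_upwards [self_mem_nhdsWithin] with s hs using hneg s hs
    intro s
    refine ⟨fun hs => ?_, fun hs => ?_⟩
    · rcases hs.eq_or_lt with rfl | h
      exacts [h0, hpos s h]
    · rcases hs.eq_or_lt with rfl | h
      exacts [h0', hneg s h]
  rw [prim]
  rcases le_total 0 t with ht | ht
  · exact intervalIntegral.integral_nonneg ht fun s hs => (cl s).1 hs.1
  · rw [intervalIntegral.integral_symm, ← intervalIntegral.integral_neg]
    exact intervalIntegral.integral_nonneg ht fun s hs => neg_nonneg.2 ((cl s).2 hs.2)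

lemma exists_mul_sq_le_prim (hf3 : Cf3 f) (B : ℝ) :
    ∃ T : ℝ, 0 < T ∧ ∀ t, T ≤ |t| → B * t ^ 2 ≤ prim f t := by
  obtain ⟨T, hT⟩ := eventually_atTop.1 (eventually_comap.1 (hf3.eventually_ge_atTop B))
  refine ⟨max T 1, by positivity, fun t ht => ?_⟩
  have h1 := hT |t| ((le_max_left _ _).trans ht) t rfl
  have h2 : 0 < |t| := one_pos.trans_le ((le_max_right _ _).trans ht)
  have h3 : 0 < t ^ 2 := by rw [← sq_abs]; positivity
  exact (le_div_iff₀ h3).1 h1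

lemma exists_setIntegral_weight_mul_sq_pos {v : EN N → ℝ} (hKpos : ∀ x, 0 < K x)
    (hi : Integrable fun x => K x * v x ^ 2) (hv0 : NotAEZero v) :
    ∃ δ : ℝ, 0 < δ ∧ 0 < ∫ x in {x | δ < |v x|}, K x * v x ^ 2 := by
  by_contra! hcon
  refine hv0 ?_
  have hnull : ∀ n : ℕ, volume {x | 1 / ((n : ℝ) + 1) < |v x|} = 0 := by
    intro n
    have hδ : 0 < 1 / ((n : ℝ) + 1) := by positivity
    have h := (setIntegral_pos_iff_support_of_nonneg_ae
      (.of_forall fun x => mul_nonneg (hKpos x).le (sq_nonneg (v x)))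
      hi.integrableOn).not.1 (hcon _ hδ).not_gt
    have h' := nonpos_iff_eq_zero.1 (not_lt.1 h)
    refine measure_mono_null (fun x (hx : 1 / ((n : ℝ) + 1) < |v x|) => ?_) h'
    exact ⟨(mul_pos (hKpos x) (sq_pos_of_ne_zero (abs_pos.1 (hδ.trans hx)))).ne', hx⟩
  refine measure_mono_null (fun x hx => ?_) (measure_iUnion_null hnull)
  obtain ⟨n, hn⟩ := exists_nat_one_div_lt (abs_pos.2 (by simpa using hx : v x ≠ 0))
  exact Set.mem_iUnion.2 ⟨n, hn⟩

lemma normSq_le_sq_mul {w : EN N → ℝ} {M : ℝ} (hVpos : ∀ x, 0 < V x)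
    (hw : ∀ x, |w x| ≤ M * |u x|) (hwd : ∀ x y, |w x - w y| ≤ M * |u x - u y|) :
    normSq α V w ≤ ENNReal.ofReal (M ^ 2) * normSq α V u := by
  have sq : ∀ a b : ℝ, |a| ≤ M * |b| → a ^ 2 ≤ M ^ 2 * b ^ 2 := fun a b h => by
    rw [← sq_abs a, ← sq_abs b, ← mul_pow]
    gcongr
  rw [normSq, normSq, gagSq, gagSq, mul_add, ← lintegral_const_mul' _ _ ENNReal.ofReal_ne_top,
    ← lintegral_const_mul' _ _ ENNReal.ofReal_ne_top]
  simp only [← ENNReal.ofReal_mul (sq_nonneg M)]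
  refine add_le_add (lintegral_mono fun p => ENNReal.ofReal_le_ofReal ?_)
    (lintegral_mono fun x => ENNReal.ofReal_le_ofReal ?_)
  · rw [← mul_div_assoc]
    gcongr
    exact sq _ _ (hwd _ _)
  · have := mul_le_mul_of_nonneg_left (sq _ _ (hw x)) (hVpos x).le
    linarith

lemma mul_setIntegral_le_integral_prim {v w : EN N → ℝ} {B T δ t : ℝ}
    (hδ : 0 < δ) (hKpos : ∀ x, 0 < K x) (hv : Measurable v)
    (hi : Integrable fun x => K x * v x ^ 2) (hiw : Integrable fun x => K x * prim f (w x))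
    (hF : ∀ s, 0 ≤ prim f s) (hT : ∀ s, T ≤ |s| → B * s ^ 2 ≤ prim f s) (ht0 : 0 ≤ t)
    (ht : T ≤ t * δ) (hw : ∀ x, v x ≠ 0 → w x = t * v x) :
    B * t ^ 2 * ∫ x in {x | δ < |v x|}, K x * v x ^ 2 ≤ ∫ x, K x * prim f (w x) := by
  have hm : MeasurableSet {x | δ < |v x|} := measurableSet_lt measurable_const hv.abs
  rw [← integral_const_mul]
  refine (setIntegral_mono_on (hi.const_mul _).integrableOn hiw.integrableOn hm
    fun x (hx : δ < |v x|) => ?_).trans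
    (setIntegral_le_integral hiw (.of_forall fun x => mul_nonneg (hKpos x).le (hF _)))
  rw [hw x (abs_pos.1 (hδ.trans hx))]
  have h1 : T ≤ |t * v x| := by
    rw [abs_mul, abs_of_nonneg ht0]
    exact ht.trans (by gcongr)
  have h2 := mul_le_mul_of_nonneg_left (hT _ h1) (hKpos x).le
  calc B * t ^ 2 * (K x * v x ^ 2) = K x * (B * (t * v x) ^ 2) := by ring
    _ ≤ _ := h2

lemma abs_fiber_sub_le {s t M : ℝ} (ht0 : 0 ≤ t) (hs0 : 0 ≤ s) (ht : t ≤ M) (hs : s ≤ M)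
    (a b : ℝ) :
    |(t * max a 0 + s * min a 0) - (t * max b 0 + s * min b 0)| ≤ M * |a - b| := by
  wlog hab : b ≤ a generalizing a b
  · rw [abs_sub_comm, abs_sub_comm a]
    exact this b a (le_of_not_ge hab)
  have h1 : 0 ≤ max a 0 - max b 0 := sub_nonneg.2 (max_le_max_right 0 hab)
  have h2 : 0 ≤ min a 0 - min b 0 := sub_nonneg.2 (min_le_min_right 0 hab)
  have h3 : (max a 0 - max b 0) + (min a 0 - min b 0) = a - b := by
    have := max_add_min a 0
    have := max_add_min b 0
    linarith
  rw [abs_of_nonneg (sub_nonneg.2 hab), ← h3, abs_of_nonneg (by nlinarith)]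
  nlinarith

end Fibering

end ZeroMass

/-- Equation (4.8): anticoercivity of the fibering map,
`J(tu⁺ + su⁻) → −∞` as `t² + s² → ∞` with `t, s ≥ 0`. -/
theorem statement17 {N : ℕ} (α : ℝ) (hα : α ∈ Set.Ioo (0 : ℝ) 1) (hN : 2 * α < N)
    (V K : EN N → ℝ) (f : ℝ → ℝ)
    (hV : Continuous V) (hK : Continuous K) (hf : Continuous f)
    (h1 : H1 V K) (h2 : H2 K) (h3 : H3 V K)
    (hf1 : Cf1 f) (hf2 : Cf2 f (critExp N α)) (hf3 : Cf3 f) (hf4 : Cf4 f)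
    (u : EN N → ℝ) (hu : memX α V u)
    (hup : NotAEZero (uplus u)) (hum : NotAEZero (uminus u)) :
    ∀ A : ℝ, ∃ ρ : ℝ, 0 < ρ ∧ ∀ t s : ℝ, 0 ≤ t → 0 ≤ s → ρ ^ 2 ≤ t ^ 2 + s ^ 2 →
      Jfun α V K f (fun x => t * uplus u x + s * uminus u x) ≤ A := by
  intro A
  have hKpos := h1.2.1
  have hKu := integrable_weight_mul_sq hK hu.1 h1 h3 (integrable_mul_sq hV hu h1.1)
  have hpm : Measurable (uplus u) := hu.1.max measurable_const
  have hmm : Measurable (uminus u) := hu.1.min measurable_const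
  have hdom : ∀ v : EN N → ℝ, Measurable v → (∀ x, |v x| ≤ |u x|) →
      Integrable fun x => K x * v x ^ 2 := fun v hv hvu => by
    refine hKu.mono' (hK.measurable.mul (hv.pow_const 2)).aestronglyMeasurable
      (.of_forall fun x => ?_)
    have := hKpos x
    rw [Real.norm_of_nonneg (by positivity)]
    gcongr ?_ * ?_
    exact sq_le_sq.2 (hvu x)
  have hip := hdom _ hpm fun x => by
    rcases le_total (u x) 0 with h | h <;> simp [uplus, h]
  have him := hdom _ hmm fun x => by
    rcases le_total (u x) 0 with h | h <;> simp [uminus, h]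
  obtain ⟨δ₁, hδ₁, hI₁⟩ := exists_setIntegral_weight_mul_sq_pos hKpos hip hup
  obtain ⟨δ₂, hδ₂, hI₂⟩ := exists_setIntegral_weight_mul_sq_pos hKpos him hum
  set I₁ := ∫ x in {x | δ₁ < |uplus u x|}, K x * uplus u x ^ 2
  set I₂ := ∫ x in {x | δ₂ < |uminus u x|}, K x * uminus u x ^ 2
  set Q := (normSq α V u).toReal with hQ
  have hQ0 : 0 ≤ Q := ENNReal.toReal_nonneg
  set B := (Q / 2 + 1) * (I₁⁻¹ + I₂⁻¹) with hB
  have hB₁ : Q / 2 + 1 ≤ B * I₁ := by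
    have : B * I₁ = (Q / 2 + 1) * (1 + I₂⁻¹ * I₁) := by rw [hB]; field_simp
    rw [this]
    exact le_mul_of_one_le_right (by positivity) (by simp; positivity)
  have hB₂ : Q / 2 + 1 ≤ B * I₂ := by
    have : B * I₂ = (Q / 2 + 1) * (I₁⁻¹ * I₂ + 1) := by rw [hB]; field_simp
    rw [this]
    exact le_mul_of_one_le_right (by positivity) (by simp; positivity)
  obtain ⟨T, hT0, hT⟩ := exists_mul_sq_le_prim hf3 B
  have hF := prim_nonneg hf hf1 hf4
  refine ⟨2 * (T / δ₁ + T / δ₂ + |A| + 1), by positivity, fun t s ht hs hts => ?_⟩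
  set w : EN N → ℝ := fun x => t * uplus u x + s * uminus u x with hw
  set M := max t s with hM
  have hM0 : 0 ≤ M := ht.trans (le_max_left _ _)
  have hMρ : T / δ₁ + T / δ₂ + |A| + 1 ≤ M := by
    by_contra! hlt
    have h4 : t ^ 2 ≤ M ^ 2 := by gcongr; exact le_max_left _ _
    have h5 : s ^ 2 ≤ M ^ 2 := by gcongr; exact le_max_right _ _
    nlinarith
  have hq₁ : 0 < T / δ₁ := by positivity
  have hq₂ : 0 < T / δ₂ := by positivity
  have hwd : ∀ x y, |w x - w y| ≤ M * |u x - u y| := fun x y =>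
    abs_fiber_sub_le ht hs (le_max_left _ _) (le_max_right _ _) _ _
  have hwu : ∀ x, |w x| ≤ M * |u x| := fun x => by
    simpa [hw, uplus, uminus] using abs_fiber_sub_le ht hs (le_max_left _ _) (le_max_right _ _) (u x) 0
  have hiw := integrable_weight_mul_prim hα.1 hN hV hK hf h1 h3 hf1 hf2 hu
    ((hpm.const_mul t).add (hmm.const_mul s)) hwu
  have hnorm : (normSq α V w).toReal ≤ M ^ 2 * Q := by
    have := ENNReal.toReal_mono (ENNReal.mul_ne_top ENNReal.ofReal_ne_top hu.2.ne)
      (normSq_le_sq_mul (α := α) h1.1 hwu hwd)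
    rwa [ENNReal.toReal_mul, ENNReal.toReal_ofReal (sq_nonneg M)] at this
  have hint : (Q / 2 + 1) * M ^ 2 ≤ ∫ x, K x * prim f (w x) := by
    rcases max_choice t s with hc | hc
    · have hwx : ∀ x, uplus u x ≠ 0 → w x = M * uplus u x := fun x hx => by
        have h0 : 0 ≤ u x := le_of_lt (by simpa [uplus] using hx)
        simp [hw, hM, hc, uminus, h0]
      have hTδ : T ≤ M * δ₁ := (div_le_iff₀ hδ₁).1 (by linarith [abs_nonneg A])
      refine le_trans ?_ (mul_setIntegral_le_integral_prim hδ₁ hKpos hpm hip hiw hF hT hM0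
        hTδ hwx)
      calc _ ≤ B * I₁ * M ^ 2 := by gcongr
        _ = _ := by ring
    · have hwx : ∀ x, uminus u x ≠ 0 → w x = M * uminus u x := fun x hx => by
        have h0 : u x ≤ 0 := le_of_lt (by simpa [uminus] using hx)
        simp [hw, hM, hc, uplus, h0]
      have hTδ : T ≤ M * δ₂ := (div_le_iff₀ hδ₂).1 (by linarith [abs_nonneg A])
      refine le_trans ?_ (mul_setIntegral_le_integral_prim hδ₂ hKpos hmm him hiw hF hT hM0
        hTδ hwx)
      calc _ ≤ B * I₂ * M ^ 2 := by gcongr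
        _ = _ := by ring
  rw [Jfun]
  have hMA : -A ≤ M ^ 2 := by nlinarith [neg_abs_le A]
  linarith
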